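/- arXiv:1506.07212 — 7 statements merged into one kernel-verified Lean document; each statement's English description precedes it below -/
import Mathlib

section
/- Let Ω be a measurable space, P a convex set of probability measures on Ω, and Γ : P → ℝ^k a property. If some loss function L : ℝ^k × Ω → ℝ elicits Γ, then every level set Γ_r = {p ∈ P : Γ(p) = r} is convex: if Γ(p) = Γ(p') = r and λ ∈ [0,1], then Γ(λp + (1−λ)p') = r. -/
open MeasureTheory

namespace Elicitation

variable {Ω : Type*} [MeasurableSpace Ω]

/-- The mixture `λ • p + (1-λ) • p'` of two measures. -/
noncomputable def mix (lam : ℝ) (p p' : Measure Ω) : Measure Ω :=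
  ENNReal.ofReal lam • p + ENNReal.ofReal (1 - lam) • p'

/-- `P` is a convex class of probability measures. -/
def ConvexClass (P : Set (Measure Ω)) : Prop :=
  (∀ p ∈ P, IsProbabilityMeasure p) ∧
    ∀ p ∈ P, ∀ p' ∈ P, ∀ lam : ℝ, 0 ≤ lam → lam ≤ 1 → mix lam p p' ∈ P

/-- A loss `L` elicits the property `Γ` on the class `P`: for every `p ∈ P`,
`Γ p` is the unique minimizer of the expected loss `r ↦ E_p[L(r,·)]`. -/
def Elicits {R : Type*} (P : Set (Measure Ω)) (L : R → Ω → ℝ)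
    (Γ : Measure Ω → R) : Prop :=
  ∀ p ∈ P, ∀ r : R, r ≠ Γ p → ∫ ω, L (Γ p) ω ∂p < ∫ ω, L r ω ∂p

/-- `V` identifies the property `Γ` on the class `P`: for every report `r` in the
range of `Γ` and every `p ∈ P`, the expectation `E_p[V(r,·)]` vanishes iff `Γ p = r`. -/
def Identifies {R ι : Type*} (P : Set (Measure Ω)) (V : R → Ω → ι → ℝ)
    (Γ : Measure Ω → R) : Prop :=
  ∀ r ∈ Γ '' P, ∀ p ∈ P, ((∀ i, ∫ ω, V r ω i ∂p = 0) ↔ Γ p = r)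

/-- `Γ` is `ℓ`-elicitable via an elicitable and identifiable `Γ̂ : P → ℝ^ℓ` and a link `f`. -/
def IsElicI {α : Type*} (P : Set (Measure Ω)) (Γ : Measure Ω → α) (ℓ : ℕ) : Prop :=
  ∃ (Γhat : Measure Ω → Fin ℓ → ℝ) (L : (Fin ℓ → ℝ) → Ω → ℝ)
    (V : (Fin ℓ → ℝ) → Ω → Fin ℓ → ℝ) (f : (Fin ℓ → ℝ) → α),
    Elicits P L Γhat ∧ Identifies P V Γhat ∧ ∀ p ∈ P, Γ p = f (Γhat p)

/-- `Γ` is `ℓ`-identifiable via an identifiable `Γ̂ : P → ℝ^ℓ` and a link `f`. -/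
def IsIden {α : Type*} (P : Set (Measure Ω)) (Γ : Measure Ω → α) (ℓ : ℕ) : Prop :=
  ∃ (Γhat : Measure Ω → Fin ℓ → ℝ) (V : (Fin ℓ → ℝ) → Ω → Fin ℓ → ℝ)
    (f : (Fin ℓ → ℝ) → α),
    Identifies P V Γhat ∧ ∀ p ∈ P, Γ p = f (Γhat p)

/-- Elicitation complexity `elic_I`, valued in `ℕ∞`. -/
noncomputable def elicI {α : Type*} (P : Set (Measure Ω)) (Γ : Measure Ω → α) : ℕ∞ :=
  sInf {n : ℕ∞ | ∃ ℓ : ℕ, n = ℓ ∧ IsElicI P Γ ℓ}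

/-- Identification complexity `iden`, valued in `ℕ∞`. -/
noncomputable def iden {α : Type*} (P : Set (Measure Ω)) (Γ : Measure Ω → α) : ℕ∞ :=
  sInf {n : ℕ∞ | ∃ ℓ : ℕ, n = ℓ ∧ IsIden P Γ ℓ}


/-- If a loss `L` elicits `Γ` on a convex class `P` of probability
measures, then every level set of `Γ` is convex. -/
theorem stmt_0 {Ω : Type*} [MeasurableSpace Ω] {k : ℕ}
    (P : Set (Measure Ω)) (hP : ConvexClass P)
    (Γ : Measure Ω → Fin k → ℝ) (L : (Fin k → ℝ) → Ω → ℝ)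
    (hInt : ∀ p ∈ P, ∀ r : Fin k → ℝ, Integrable (L r) p)
    (hL : Elicits P L Γ)
    {p p' : Measure Ω} (hp : p ∈ P) (hp' : p' ∈ P)
    {r : Fin k → ℝ} (hΓp : Γ p = r) (hΓp' : Γ p' = r)
    {lam : ℝ} (h0 : 0 ≤ lam) (h1 : lam ≤ 1) :
    Γ (mix lam p p') = r := by
  have key : ∀ s, ∫ ω, L s ω ∂(mix lam p p') =
      lam * ∫ ω, L s ω ∂p + (1 - lam) * ∫ ω, L s ω ∂p' := by
    intro s
    unfold mix
    rw [integral_add_measure ((hInt p hp s).smul_measure ENNReal.ofReal_ne_top)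
      ((hInt p' hp' s).smul_measure ENNReal.ofReal_ne_top),
      integral_smul_measure, integral_smul_measure,
      ENNReal.toReal_ofReal h0, ENNReal.toReal_ofReal (sub_nonneg.2 h1)]
    simp only [smul_eq_mul]
  by_contra hne
  have hm := hL _ (hP.2 p hp p' hp' lam h0 h1) r (Ne.symm hne)
  have a := hL p hp (Γ (mix lam p p')) (by rw [hΓp]; exact hne)
  have b := hL p' hp' (Γ (mix lam p p')) (by rw [hΓp']; exact hne)
  rw [hΓp] at a
  rw [hΓp'] at b
  rw [key, key] at hm
  have c := mul_le_mul_of_nonneg_left a.le h0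
  have d := mul_le_mul_of_nonneg_left b.le (sub_nonneg.2 h1)
  linarith

end Elicitation
end

section
/- Let Ω = ℝ with the Borel σ-algebra and P a convex set of Borel probability measures on ℝ. Then every property Γ : P → ℝ^m has countable elicitation complexity: there exist a map Γ̂ : P → ℝ^ℕ, a loss L : ℝ^ℕ × ℝ → ℝ such that for every p ∈ P, Γ̂(p) is the unique minimizer of r ↦ E_p[L(r,·)], a function V : ℝ^ℕ × ℝ → ℝ^ℕ with E_p[V(r,·)] = 0 iff Γ̂(p) = r (for r ∈ Γ̂(P)), and a function f : ℝ^ℕ → ℝ^m with Γ = f ∘ Γ̂. One may take Γ̂(p)_i = F_p(q_i) for an enumeration (q_i) of the rationals, F_p the CDF of p, with loss L((r_i)_{i∈ℕ}, y) = Σ_{i∈ℕ} β^i (r_i − 1_{y ≤ q_i})² for any fixed 0 < β < 1. -/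
open MeasureTheory

namespace Elicitation

variable {Ω : Type*} [MeasurableSpace Ω]

/-- The indicator of `y ≤ q`. -/
noncomputable def below (q : ℚ) : ℝ → ℝ := (Set.Iic (q : ℝ)).indicator 1

lemma below_cases (q : ℚ) (y : ℝ) : below q y = 0 ∨ below q y = 1 := by
  unfold below
  by_cases h : y ∈ Set.Iic (q : ℝ) <;> simp [h]

lemma below_integrable (q : ℚ) (p : Measure ℝ) [IsProbabilityMeasure p] :
    Integrable (below q) p := by
  unfold below
  exact (integrable_const (1 : ℝ)).indicator measurableSet_Iic

lemma below_integral (q : ℚ) (p : Measure ℝ) : ∫ y, below q y ∂p = p.real (Set.Iic (q : ℝ)) := by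
  unfold below
  exact integral_indicator_one measurableSet_Iic

lemma sq_eq (q : ℚ) (c : ℝ) :
    (fun y => (c - below q y) ^ 2) = fun y => c ^ 2 + (1 - 2 * c) * below q y := by
  funext y
  rcases below_cases q y with h | h <;> rw [h] <;> ring

lemma sq_integrable (q : ℚ) (c : ℝ) (p : Measure ℝ) [IsProbabilityMeasure p] :
    Integrable (fun y => (c - below q y) ^ 2) p := by
  rw [sq_eq]
  exact (integrable_const _).add ((below_integrable q p).const_mul _)

lemma sq_integral (q : ℚ) (c : ℝ) (p : Measure ℝ) [IsProbabilityMeasure p] :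
    ∫ y, (c - below q y) ^ 2 ∂p = (c - p.real (Set.Iic (q : ℝ))) ^ 2 +
      (p.real (Set.Iic (q : ℝ)) - p.real (Set.Iic (q : ℝ)) ^ 2) := by
  rw [sq_eq, integral_add (integrable_const _) ((below_integrable q p).const_mul _),
    integral_const_mul, below_integral]
  simp
  ring

lemma sq_integral_le (q : ℚ) (c : ℝ) (h0 : 0 ≤ c) (h1 : c ≤ 1) (p : Measure ℝ)
    [IsProbabilityMeasure p] : ∫ y, (c - below q y) ^ 2 ∂p ≤ 1 := by
  have : ∫ y, (c - below q y) ^ 2 ∂p ≤ ∫ _y, (1 : ℝ) ∂p := by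
    refine integral_mono (sq_integrable q c p) (integrable_const _) fun y => ?_
    rcases below_cases q y with h | h <;> simp only [h] <;> nlinarith
  simpa using this

lemma sq_integral_nonneg (q : ℚ) (c : ℝ) (p : Measure ℝ) :
    0 ≤ ∫ y, (c - below q y) ^ 2 ∂p := integral_nonneg fun _ => sq_nonneg _

/-- Unit cube in `ℝ^ℕ`. -/
def Box (r : ℕ → ℝ) : Prop := ∀ i, 0 ≤ r i ∧ r i ≤ 1

open Classical in
/-- The loss: the discounted sum of squared errors on the unit cube, a large constant outside. -/
noncomputable def loss (q : ℕ → ℚ) (r : ℕ → ℝ) (y : ℝ) : ℝ :=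
  if Box r then ∑' i, (1 / 2 : ℝ) ^ i * (r i - below (q i) y) ^ 2 else 3

lemma summable_terms (q : ℕ → ℚ) (r : ℕ → ℝ) (hr : Box r) (p : Measure ℝ)
    [IsProbabilityMeasure p] :
    Summable fun i => (1 / 2 : ℝ) ^ i * ∫ y, (r i - below (q i) y) ^ 2 ∂p := by
  refine Summable.of_nonneg_of_le
    (fun i => mul_nonneg (by positivity) (sq_integral_nonneg _ _ _)) (fun i => ?_)
    summable_geometric_two
  exact mul_le_of_le_one_right (by positivity) (sq_integral_le _ _ (hr i).1 (hr i).2 p)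

lemma loss_integral (q : ℕ → ℚ) (r : ℕ → ℝ) (hr : Box r) (p : Measure ℝ)
    [IsProbabilityMeasure p] :
    ∫ y, loss q r y ∂p = ∑' i, (1 / 2 : ℝ) ^ i * ∫ y, (r i - below (q i) y) ^ 2 ∂p := by
  simp only [loss, if_pos hr]
  rw [← integral_tsum_of_summable_integral_norm]
  · simp only [integral_const_mul]
  · exact fun i => (sq_integrable _ _ p).const_mul _
  · refine (summable_terms q r hr p).congr fun i => ?_
    rw [← integral_const_mul]
    refine integral_congr_ae (Filter.Eventually.of_forall fun y => ?_)
    exact (Real.norm_of_nonneg (mul_nonneg (by positivity) (sq_nonneg _))).symm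

/-- The rational CDF values. -/
noncomputable def cdfHat (q : ℕ → ℚ) (p : Measure ℝ) (i : ℕ) : ℝ := p.real (Set.Iic (q i : ℝ))

lemma box_cdfHat (q : ℕ → ℚ) (p : Measure ℝ) [IsProbabilityMeasure p] : Box (cdfHat q p) :=
  fun _ => ⟨measureReal_nonneg, measureReal_le_one⟩

lemma cdfHat_inj (q : ℕ → ℚ) (hq : Function.Surjective q) (p p' : Measure ℝ)
    [IsProbabilityMeasure p] [IsProbabilityMeasure p'] (h : cdfHat q p = cdfHat q p') :
    p = p' := by
  refine ext_of_generate_finite _ ((BorelSpace.measurable_eq).trans Real.borel_eq_generateFrom_Iic_rat) Real.isPiSystem_Iic_rat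
    ?_ (by simp)
  intro s hs
  simp only [Set.mem_iUnion, Set.mem_singleton_iff] at hs
  obtain ⟨a, rfl⟩ := hs
  obtain ⟨i, rfl⟩ := hq a
  have := congrFun h i
  simpa [cdfHat, measureReal_def, ENNReal.toReal_eq_toReal_iff'] using this

theorem stmt_3 (P : Set (Measure ℝ)) (hP : ConvexClass P) {m : ℕ}
    (Γ : Measure ℝ → Fin m → ℝ) :
    ∃ (Γhat : Measure ℝ → ℕ → ℝ) (L : (ℕ → ℝ) → ℝ → ℝ)
      (V : (ℕ → ℝ) → ℝ → ℕ → ℝ) (f : (ℕ → ℝ) → Fin m → ℝ),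
      Elicits P L Γhat ∧ Identifies P V Γhat ∧ ∀ p ∈ P, Γ p = f (Γhat p) := by
  classical
  obtain ⟨q, hq⟩ := exists_surjective_nat ℚ
  refine ⟨cdfHat q, loss q, fun r y i => r i - below (q i) y,
    fun x => if h : ∃ p ∈ P, cdfHat q p = x then Γ h.choose else 0, ?_, ?_, ?_⟩
  · intro p hp r hr
    haveI := hP.1 p hp
    rw [loss_integral q _ (box_cdfHat q p)]
    by_cases hb : Box r
    · rw [loss_integral q r hb]
      obtain ⟨i, hi⟩ := Function.ne_iff.1 hr
      refine Summable.tsum_lt_tsum (i := i) (fun j => ?_) ?_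
        (summable_terms q _ (box_cdfHat q p) p) (summable_terms q r hb p)
      · refine mul_le_mul_of_nonneg_left ?_ (by positivity)
        rw [sq_integral, sq_integral]
        have := sq_nonneg (r j - p.real (Set.Iic (q j : ℝ)))
        simp only [cdfHat, sub_self]
        linarith
      · refine mul_lt_mul_of_pos_left ?_ (by positivity)
        rw [sq_integral, sq_integral]
        have : 0 < (r i - p.real (Set.Iic (q i : ℝ))) ^ 2 := by
          have := sub_ne_zero.2 hi
          unfold cdfHat at this
          positivity
        simp only [cdfHat, sub_self]
        linarith
    · have h3 : ∫ y, loss q r y ∂p = 3 := by simp [loss, if_neg hb]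
      rw [h3]
      have : _ ≤ ∑' i : ℕ, (1 / 2 : ℝ) ^ i :=
        Summable.tsum_le_tsum (fun i => mul_le_of_le_one_right (by positivity)
          (sq_integral_le (q i) _ (box_cdfHat q p i).1 (box_cdfHat q p i).2 p))
          (summable_terms q _ (box_cdfHat q p) p) summable_geometric_two
      rw [tsum_geometric_two] at this
      linarith
  · intro r _ p hp
    haveI := hP.1 p hp
    have key : ∀ i, ∫ y, (r i - below (q i) y) ∂p = r i - cdfHat q p i := fun i => by
      rw [integral_sub (integrable_const _) (below_integrable _ p), below_integral]
      simp [cdfHat]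
    simp only [key]
    constructor
    · intro h
      funext i
      linarith [h i]
    · rintro rfl i
      simp
  · intro p hp
    have h : ∃ p' ∈ P, cdfHat q p' = cdfHat q p := ⟨p, hp, rfl⟩
    haveI := hP.1 p hp
    haveI := hP.1 _ h.choose_spec.1
    have := cdfHat_inj q hq _ _ h.choose_spec.2
    simp only [dif_pos h]
    rw [this]

end Elicitation
end

section
/- Let Ω be a measurable space, P a convex set of probability measures on Ω, and X : Ω → ℝ^k integrable with respect to every p ∈ P. Define the linear property Γ : P → ℝ^k by Γ(p) = E_p[X]. Then elic_I(Γ) = dim(affineHull(Γ(P))), the dimension of the affine hull of the range of Γ. -/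
open MeasureTheory

namespace Elicitation

variable {Ω : Type*} [MeasurableSpace Ω]

theorem mixture_mem {Ω : Type*} [MeasurableSpace Ω] (P : Set (Measure Ω)) (hP : ConvexClass P)
    {ι : Type*} (q : ι → Measure Ω) (hq : ∀ j, q j ∈ P) (s : Finset ι) (hs : s.Nonempty) :
    ∀ w : ι → ℝ, (∀ j, 0 < w j) → ∑ j ∈ s, w j = 1 →
      ∑ j ∈ s, ENNReal.ofReal (w j) • q j ∈ P := by
  induction hs using Finset.Nonempty.cons_induction with
  | singleton a =>
    intro w hw h1
    simp at h1
    simpa [h1] using hq a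
  | cons a s ha hs ih =>
    intro w hw h1
    rw [Finset.sum_cons] at h1 ⊢
    set c := ∑ j ∈ s, w j with hc
    have hc0 : 0 < c := Finset.sum_pos (fun j _ => hw j) hs
    have h2 := ih (fun j => w j / c) (fun j => div_pos (hw j) hc0)
      (by rw [← Finset.sum_div]; exact div_self hc0.ne')
    have h3 := hP.2 (q a) (hq a) _ h2 (w a) (hw a).le (by linarith)
    convert h3 using 1
    unfold mix
    congr 1
    rw [Finset.smul_sum]
    refine Finset.sum_congr rfl fun j _ => ?_
    rw [smul_smul, ← ENNReal.ofReal_mul (by linarith)]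
    congr 2
    have : 1 - w a = c := by linarith
    rw [this]
    field_simp

theorem lower {Ω : Type*} [MeasurableSpace Ω] {k : ℕ}
    (P : Set (Measure Ω)) (hP : ConvexClass P)
    (X : Ω → Fin k → ℝ) (hX : ∀ p ∈ P, Integrable X p)
    (Γ : Measure Ω → Fin k → ℝ) (hΓ : ∀ p ∈ P, Γ p = ∫ ω, X ω ∂p) (ℓ : ℕ)
    (h : IsElicI P Γ ℓ) :
    Module.finrank ℝ (affineSpan ℝ (Γ '' P)).direction ≤ ℓ := by
  obtain ⟨Γhat, L, V, f, -, hV, hf⟩ := h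
  by_contra hlt
  push Not at hlt
  obtain ⟨t, hts, htspan, hind⟩ := exists_affineIndependent ℝ (Fin k → ℝ) (Γ '' P)
  rw [← htspan, direction_affineSpan] at hlt
  have hfin : Finite t := finite_of_fin_dim_affineIndependent ℝ hind
  cases nonempty_fintype t
  have hne : Nonempty t := by
    by_contra hempty
    rw [not_nonempty_iff, Set.isEmpty_coe_sort] at hempty
    subst hempty
    rw [vectorSpan_empty, finrank_bot] at hlt
    exact absurd hlt (Nat.not_lt_zero _)
  have hcard : Module.finrank ℝ (vectorSpan ℝ t) + 1 = Fintype.card t := by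
    have := hind.finrank_vectorSpan_add_one
    rwa [Subtype.range_coe] at this
  choose q hq hqΓ using fun j : t => hts j.2
  set N : ℝ := (Fintype.card t : ℝ) with hN
  have hN0 : 0 < N := by rw [hN]; exact_mod_cast Fintype.card_pos
  let m : (t → ℝ) → Measure Ω := fun w => ∑ j, ENNReal.ofReal (w j) • q j
  have hm : ∀ w : t → ℝ, (∀ j, 0 < w j) → ∑ j, w j = 1 → m w ∈ P := fun w hw h1 =>
    mixture_mem P hP q hq Finset.univ Finset.univ_nonempty w hw h1
  have hmint : ∀ {E : Type} [NormedAddCommGroup E] [NormedSpace ℝ E] (g : Ω → E),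
      (∀ j, Integrable g (q j)) → ∀ w : t → ℝ, (∀ j, 0 < w j) →
      ∫ ω, g ω ∂(m w) = ∑ j, w j • ∫ ω, g ω ∂(q j) := by
    intro E _ _ g hg w hw
    rw [integral_finset_sum_measure (fun j _ => (hg j).smul_measure ENNReal.ofReal_ne_top)]
    refine Finset.sum_congr rfl fun j _ => ?_
    rw [integral_smul_measure, ENNReal.toReal_ofReal (hw j).le]
  have hmnot : ∀ (g : Ω → ℝ), (¬ ∀ j, Integrable g (q j)) → ∀ w : t → ℝ, (∀ j, 0 < w j) →
      ∫ ω, g ω ∂(m w) = 0 := by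
    intro g hg w hw
    refine integral_undef fun hi => hg fun j => ?_
    have h1 := (integrable_finset_sum_measure.1 hi) j (Finset.mem_univ j)
    rwa [integrable_smul_measure (by simpa using hw j) ENNReal.ofReal_ne_top] at h1
  let w0 : t → ℝ := fun _ => 1 / N
  have hw0 : ∀ j, 0 < w0 j := fun j => by positivity
  have hw01 : ∑ j, w0 j = 1 := by
    simp only [w0, Finset.sum_const, Finset.card_univ, nsmul_eq_mul]
    rw [← hN]; field_simp
  let r := Γhat (m w0)
  classical
  let a : Fin ℓ → t → ℝ := fun i j =>
    if ∀ j, Integrable (fun ω => V r ω i) (q j) then ∫ ω, V r ω i ∂(q j) else 0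
  have ha : ∀ i (w : t → ℝ), (∀ j, 0 < w j) → ∫ ω, V r ω i ∂(m w) = ∑ j, w j * a i j := by
    intro i w hw
    by_cases hi : ∀ j, Integrable (fun ω => V r ω i) (q j)
    · rw [hmint _ hi w hw]
      simp only [a, if_pos hi, smul_eq_mul]
    · rw [hmnot _ hi w hw]
      simp only [a, if_neg hi, mul_zero, Finset.sum_const_zero]
  let A : (t → ℝ) →ₗ[ℝ] (Option (Fin ℓ) → ℝ) :=
    LinearMap.pi fun o => ∑ j, (match o with | none => (1 : ℝ) | some i => a i j) •
      LinearMap.proj (R := ℝ) (φ := fun _ : t => ℝ) j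
  have hker : LinearMap.ker A ≠ ⊥ := by
    apply LinearMap.ker_ne_bot_of_finrank_lt
    simp only [Module.finrank_fintype_fun_eq_card, Fintype.card_option, Fintype.card_fin]
    omega
  obtain ⟨δ, hδ, hδ0⟩ := Submodule.exists_mem_ne_zero_of_ne_bot hker
  rw [LinearMap.mem_ker] at hδ
  have hδsum : ∑ j, δ j = 0 := by
    have := congrFun hδ none
    simpa [A] using this
  have hδa : ∀ i, ∑ j, δ j * a i j = 0 := by
    intro i
    have := congrFun hδ (some i)
    simpa [A, mul_comm] using this
  set M : ℝ := 1 + ∑ j, |δ j| with hM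
  have hMpos : 0 < M := by positivity
  let w : t → ℝ := fun j => w0 j + (1 / (N * M)) * δ j
  have hw : ∀ j, 0 < w j := by
    intro j
    have h1 : |δ j| ≤ ∑ j, |δ j| :=
      Finset.single_le_sum (f := fun j => |δ j|) (fun _ _ => abs_nonneg _) (Finset.mem_univ j)
    have h2 : 0 < M + δ j := by linarith [neg_abs_le (δ j)]
    have h3 : w j = (M + δ j) / (N * M) := by
      simp only [w, w0]; field_simp
    rw [h3]; positivity
  have hw1 : ∑ j, w j = 1 := by
    simp only [w, Finset.sum_add_distrib, ← Finset.mul_sum, hδsum, hw01]; simp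
  have hm0 := hm w0 hw0 hw01
  have hmw := hm w hw hw1
  have hz0 := (hV r ⟨_, hm0, rfl⟩ _ hm0).2 rfl
  have hz : Γhat (m w) = r := by
    refine (hV r ⟨_, hm0, rfl⟩ _ hmw).1 fun i => ?_
    have h0 := hz0 i
    rw [ha i w0 hw0] at h0
    rw [ha i w hw]
    simp only [w, add_mul, Finset.sum_add_distrib, mul_assoc, ← Finset.mul_sum, hδa, h0]
    simp
  have hΓeq : Γ (m w) = Γ (m w0) := by rw [hf _ hmw, hf _ hm0, hz]
  have hΓm : ∀ w : t → ℝ, (∀ j, 0 < w j) → ∑ j, w j = 1 →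
      Γ (m w) = ∑ j, w j • (j : Fin k → ℝ) := by
    intro w hw h1
    rw [hΓ _ (hm w hw h1), hmint X (fun j => hX _ (hq j)) w hw]
    refine Finset.sum_congr rfl fun j _ => ?_
    rw [← hΓ _ (hq j), hqΓ j]
  rw [hΓm w hw hw1, hΓm w0 hw0 hw01] at hΓeq
  simp only [w, add_smul, Finset.sum_add_distrib, mul_smul, ← Finset.smul_sum] at hΓeq
  have h4 : (1 / (N * M)) • ∑ j, δ j • (j : Fin k → ℝ) = 0 := by simpa using hΓeq
  have h5 : ∑ j, δ j • (j : Fin k → ℝ) = 0 :=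
    (smul_eq_zero.1 h4).resolve_left (by positivity)
  exact hδ0 (funext fun j =>
    affineIndependent_iff.1 hind Finset.univ δ hδsum h5 j (Finset.mem_univ j))

theorem upper {Ω : Type*} [MeasurableSpace Ω] {k : ℕ}
    (P : Set (Measure Ω)) (hP : ConvexClass P)
    (X : Ω → Fin k → ℝ) (hX : ∀ p ∈ P, Integrable X p)
    (Γ : Measure Ω → Fin k → ℝ) (hΓ : ∀ p ∈ P, Γ p = ∫ ω, X ω ∂p) :
    IsElicI P Γ (Module.finrank ℝ (affineSpan ℝ (Γ '' P)).direction) := by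
  set D := (affineSpan ℝ (Γ '' P)).direction with hD
  obtain ⟨g, hg⟩ := D.subtype.exists_leftInverse_of_injective (by simp)
  let e := (Module.finBasis ℝ D).equivFun
  let T : (Fin k → ℝ) →ₗ[ℝ] (Fin (Module.finrank ℝ D) → ℝ) := e.toLinearMap ∘ₗ g
  let S : (Fin (Module.finrank ℝ D) → ℝ) →ₗ[ℝ] (Fin k → ℝ) := D.subtype ∘ₗ e.symm.toLinearMap
  have hST : ∀ v ∈ D, S (T v) = v := by
    intro v hv
    have := LinearMap.congr_fun hg ⟨v, hv⟩
    simp at this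
    simp [S, T, this]
  let Tc := LinearMap.toContinuousLinearMap T
  have hTi : ∀ p ∈ P, ∀ i, Integrable (fun ω => T (X ω) i) p := fun p hp i =>
    (Tc.integrable_comp (hX p hp)).eval i
  have hTe : ∀ p ∈ P, ∀ i, ∫ ω, T (X ω) i ∂p = T (Γ p) i := by
    intro p hp i
    rw [hΓ p hp]
    have h1 := ((ContinuousLinearMap.proj (R := ℝ) (φ := fun _ => ℝ) i).comp Tc).integral_comp_comm
      (hX p hp)
    simpa [Tc] using h1
  rcases P.eq_empty_or_nonempty with hemp | ⟨p0, hp0⟩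
  · subst hemp
    exact ⟨fun _ => 0, fun _ _ => 0, fun _ _ => 0, fun _ => 0, by simp [Elicits],
      by simp [Identifies], by simp⟩
  refine ⟨fun p => T (Γ p), fun r ω => ∑ i, (r i ^ 2 - 2 * r i * T (X ω) i),
    fun r ω i => r i - T (X ω) i, fun y => Γ p0 + S (y - T (Γ p0)), ?_, ?_, ?_⟩
  · intro p hp r hr
    have := hP.1 p hp
    have hL : ∀ r : Fin (Module.finrank ℝ D) → ℝ,
        ∫ ω, ∑ i, (r i ^ 2 - 2 * r i * T (X ω) i) ∂p =
          ∑ i, (r i ^ 2 - 2 * r i * T (Γ p) i) := by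
      intro r
      have hint : ∀ i, Integrable (fun ω => r i ^ 2 - 2 * r i * T (X ω) i) p := fun i =>
        (integrable_const _).sub ((hTi p hp i).const_mul _)
      rw [integral_finsetSum _ fun i _ => hint i]
      refine Finset.sum_congr rfl fun i _ => ?_
      rw [integral_sub (integrable_const _) ((hTi p hp i).const_mul _), integral_const_mul,
        hTe p hp i]
      simp
    simp only [hL]
    obtain ⟨i, hi⟩ := Function.ne_iff.1 hr
    refine Finset.sum_lt_sum (fun i _ => ?_) ⟨i, Finset.mem_univ i, ?_⟩
    · nlinarith [sq_nonneg (r i - T (Γ p) i)]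
    · have : 0 < (r i - T (Γ p) i) ^ 2 := by
        have := sub_ne_zero.2 hi
        positivity
      nlinarith
  · intro r _ p hp
    have := hP.1 p hp
    have h1 : ∀ i, ∫ ω, (r i - T (X ω) i) ∂p = r i - T (Γ p) i := by
      intro i
      rw [integral_sub (integrable_const _) (hTi p hp i), hTe p hp i]
      simp
    simp only [h1, sub_eq_zero]
    exact ⟨fun h => funext fun i => (h i).symm, fun h i => (congrFun h i).symm⟩
  · intro p hp
    have hd : Γ p - Γ p0 ∈ D := by
      rw [hD, direction_affineSpan]
      exact vsub_mem_vectorSpan ℝ ⟨p, hp, rfl⟩ ⟨p0, hp0, rfl⟩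
    show Γ p = Γ p0 + S (T (Γ p) - T (Γ p0))
    rw [← map_sub, hST _ hd]
    abel

/-- For an integrable `X : Ω → ℝ^k`, the linear property
`Γ(p) = E_p[X]` has `elic_I(Γ) = dim (affineHull (Γ(P)))`. -/
theorem stmt_4 {Ω : Type*} [MeasurableSpace Ω] {k : ℕ}
    (P : Set (Measure Ω)) (hP : ConvexClass P)
    (X : Ω → Fin k → ℝ) (hX : ∀ p ∈ P, Integrable X p)
    (Γ : Measure Ω → Fin k → ℝ) (hΓ : ∀ p ∈ P, Γ p = ∫ ω, X ω ∂p) :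
    elicI P Γ = (Module.finrank ℝ (affineSpan ℝ (Γ '' P)).direction : ℕ∞) := by
  refine le_antisymm (sInf_le ⟨_, rfl, upper P hP X hX Γ hΓ⟩) (le_sInf ?_)
  rintro _ ⟨ℓ, rfl, h⟩
  exact_mod_cast lower P hP X hX Γ hΓ ℓ h

end Elicitation
end

section
/- Let L : ℝ^k × Ω → ℝ be a loss eliciting Γ : P → ℝ^k, with Bayes risk L̄(p) := inf_{a∈ℝ^k} E_p[L(a,·)] = E_p[L(Γ(p),·)]. Let L' : ℝ^k × Ω → ℝ be any (possibly other) loss eliciting Γ, let h : ℝ → (0,∞) be strictly decreasing, and H(r) = ∫_0^r h(x) dx. Then the loss L*((r,a), ω) = L'(a,ω) + H(r) + h(r)(L(a,ω) − r) elicits the pair (L̄, Γ): for every p ∈ P, (L̄(p), Γ(p)) is the unique minimizer over (r,a) ∈ ℝ × ℝ^k of E_p[L*((r,a),·)]. Moreover, if V : ℝ^k × Ω → ℝ^k identifies Γ, then V'((r,a), ω) = (V(a,ω), L(a,ω) − r) identifies the pair (L̄, Γ), and hence elic_I(L̄) ≤ k + 1. -/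
open MeasureTheory

namespace Elicitation

variable {Ω : Type*} [MeasurableSpace Ω]

theorem H_weak (h : ℝ → ℝ) (hdec : StrictAnti h)
    (H : ℝ → ℝ) (hH : ∀ r, H r = ∫ x in (0:ℝ)..r, h x) (x y : ℝ) :
    H y - H x ≤ h x * (y - x) := by
  have hi : ∀ a b : ℝ, IntervalIntegrable h volume a b :=
    fun a b => (hdec.antitone.antitoneOn _).intervalIntegrable
  have e : H y - H x = ∫ t in x..y, h t := by
    rw [hH, hH, intervalIntegral.integral_interval_sub_left (hi _ _) (hi _ _)]
  rw [e]
  rcases le_total x y with hxy | hxy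
  · have := intervalIntegral.integral_mono_on hxy (hi x y)
      (intervalIntegrable_const (c := h x)) (fun t ht => hdec.antitone ht.1)
    rw [intervalIntegral.integral_const, smul_eq_mul] at this
    linarith
  · have := intervalIntegral.integral_mono_on hxy
      (intervalIntegrable_const (c := h x)) (hi y x) (fun t ht => hdec.antitone ht.2)
    rw [intervalIntegral.integral_const, smul_eq_mul] at this
    rw [intervalIntegral.integral_symm]
    linarith

theorem H_strict (h : ℝ → ℝ) (hdec : StrictAnti h)
    (H : ℝ → ℝ) (hH : ∀ r, H r = ∫ x in (0:ℝ)..r, h x) (x y : ℝ) (hne : x ≠ y) :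
    H y < H x + h x * (y - x) := by
  have h1 := H_weak h hdec H hH x ((x + y) / 2)
  have h2 := H_weak h hdec H hH ((x + y) / 2) y
  have h3 : (h ((x + y) / 2) - h x) * (y - x) < 0 := by
    rcases lt_or_gt_of_ne hne with hxy | hxy
    · have : h ((x + y) / 2) < h x := hdec (by linarith)
      exact mul_neg_of_neg_of_pos (by linarith) (by linarith)
    · have : h x < h ((x + y) / 2) := hdec (by linarith)
      exact mul_neg_of_pos_of_neg (by linarith) (by linarith)
  nlinarith

/-- If `L` elicits `Γ` with Bayes risk `L̄(p) = E_p[L(Γ(p),·)]`, `L'` is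
any loss eliciting `Γ`, `h` is positive and strictly decreasing with `H(r) = ∫_0^r h`,
then `L*((r,a),ω) = L'(a,ω) + H(r) + h(r)(L(a,ω) − r)` elicits the pair `(L̄, Γ)`;
moreover if `V` identifies `Γ`, then `V'((r,a),ω) = (V(a,ω), L(a,ω) − r)` identifies
the pair `(L̄, Γ)`, and hence `elic_I(L̄) ≤ k + 1`. -/
theorem stmt_8 {Ω : Type*} [MeasurableSpace Ω] {k : ℕ}
    (P : Set (Measure Ω)) (hP : ConvexClass P)
    (L : (Fin k → ℝ) → Ω → ℝ) (Γ : Measure Ω → Fin k → ℝ)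
    (hint : ∀ p ∈ P, ∀ a : Fin k → ℝ, Integrable (L a) p)
    (hL : Elicits P L Γ)
    (L' : (Fin k → ℝ) → Ω → ℝ)
    (hint' : ∀ p ∈ P, ∀ a : Fin k → ℝ, Integrable (L' a) p)
    (hL' : Elicits P L' Γ)
    (h : ℝ → ℝ) (hpos : ∀ r, 0 < h r) (hdec : StrictAnti h)
    (H : ℝ → ℝ) (hH : ∀ r, H r = ∫ x in (0:ℝ)..r, h x)
    (Lbar : Measure Ω → ℝ) (hLbar : ∀ p ∈ P, Lbar p = ∫ ω, L (Γ p) ω ∂p)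
    (V : (Fin k → ℝ) → Ω → Fin k → ℝ) (hV : Identifies P V Γ) :
    Elicits P
      (fun ra : ℝ × (Fin k → ℝ) => fun ω =>
        L' ra.2 ω + H ra.1 + h ra.1 * (L ra.2 ω - ra.1))
      (fun p => (Lbar p, Γ p)) ∧
    Identifies P
      (fun ra : ℝ × (Fin k → ℝ) => fun ω =>
        Sum.elim (V ra.2 ω) (fun _ : Unit => L ra.2 ω - ra.1))
      (fun p => (Lbar p, Γ p)) ∧
    IsElicI P Lbar (k + 1) := by
  have hE : Elicits P
      (fun ra : ℝ × (Fin k → ℝ) => fun ω =>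
        L' ra.2 ω + H ra.1 + h ra.1 * (L ra.2 ω - ra.1))
      (fun p => (Lbar p, Γ p)) := by
    intro p hp ra hne
    have := hP.1 p hp
    obtain ⟨r, a⟩ := ra
    have key : ∀ (r : ℝ) (a : Fin k → ℝ),
        ∫ ω, (L' a ω + H r + h r * (L a ω - r)) ∂p
          = ∫ ω, L' a ω ∂p + H r + h r * (∫ ω, L a ω ∂p - r) := by
      intro r a
      have i1 := hint p hp a
      have i2 := hint' p hp a
      have i3 : Integrable (fun ω => L a ω - r) p := i1.sub (integrable_const r)
      have i4 : Integrable (fun ω => L' a ω + H r) p := i2.add (integrable_const _)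
      rw [integral_add i4 (i3.const_mul _), integral_add i2 (integrable_const _),
        integral_const_mul, integral_sub i1 (integrable_const r)]
      simp
    simp only [key]
    rw [← hLbar p hp]
    have hs := H_strict h hdec H hH r (Lbar p)
    have hr := hpos r
    by_cases ha : a = Γ p
    · subst ha
      have hrne : r ≠ Lbar p := by
        rintro rfl
        exact hne rfl
      have := hs hrne
      rw [← hLbar p hp]
      linarith
    · have h1 := hL p hp a ha
      have h2 := hL' p hp a ha
      rw [← hLbar p hp] at h1
      have h3 := H_weak h hdec H hH r (Lbar p)
      have h4 := mul_pos hr (sub_pos.2 h1)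
      linarith
  have hI : Identifies P
      (fun ra : ℝ × (Fin k → ℝ) => fun ω =>
        Sum.elim (V ra.2 ω) (fun _ : Unit => L ra.2 ω - ra.1))
      (fun p => (Lbar p, Γ p)) := by
    rintro _ ⟨q, hq, rfl⟩ p hp
    have := hP.1 p hp
    have hVq := hV (Γ q) ⟨q, hq, rfl⟩ p hp
    have e : ∫ ω, (L (Γ q) ω - Lbar q) ∂p = ∫ ω, L (Γ q) ω ∂p - Lbar q := by
      rw [integral_sub (hint p hp _) (integrable_const _)]
      simp
    simp only [Sum.forall, Sum.elim_inl, Sum.elim_inr, Prod.mk.injEq, hVq, e]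
    constructor
    · rintro ⟨hg, hl⟩
      have := hl ()
      rw [← hg, ← hLbar p hp] at this
      exact ⟨by linarith, hg⟩
    · rintro ⟨hl, hg⟩
      refine ⟨hg, fun _ => ?_⟩
      rw [← hg, ← hLbar p hp]
      linarith
  refine ⟨hE, hI, fun p => Fin.cons (Lbar p) (Γ p),
    fun x ω => L' (Fin.tail x) ω + H (x 0) + h (x 0) * (L (Fin.tail x) ω - x 0),
    fun x ω => Fin.cons (L (Fin.tail x) ω - x 0) (V (Fin.tail x) ω),
    fun x => x 0, ?_, ?_, fun p _ => by simp⟩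
  · intro p hp x hx
    have := hE p hp (x 0, Fin.tail x) (by
      intro heq
      rw [Prod.mk.injEq] at heq
      apply hx
      beta_reduce
      rw [← heq.1, ← heq.2, Fin.cons_self_tail])
    simpa using this
  · rintro _ ⟨q, hq, rfl⟩ p hp
    have := hI (Lbar q, Γ q) ⟨q, hq, rfl⟩ p hp
    simp only [Sum.forall, Sum.elim_inl, Sum.elim_inr, Prod.mk.injEq] at this
    simp only [Fin.forall_fin_succ, Fin.cons_zero, Fin.cons_succ, Fin.tail_cons,
      Fin.cons_inj]
    rw [← this]
    exact ⟨fun hh => ⟨hh.2, fun _ => hh.1⟩, fun hh => ⟨hh.2 (), hh.1⟩⟩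

end Elicitation
end

section
/- Suppose the loss L : ℝ^k × Ω → ℝ elicits Γ : P → ℝ^k, and let L̄(p) = inf_{a∈ℝ^k} E_p[L(a,·)] = E_p[L(Γ(p),·)] be its Bayes risk. Then for any p, p' ∈ P with Γ(p) ≠ Γ(p') and any λ ∈ (0,1), L̄(λp + (1−λ)p') > λ L̄(p) + (1−λ) L̄(p'); i.e., the Bayes risk is strictly concave along any segment joining two distributions whose property values differ. -/
open MeasureTheory

namespace Elicitation

variable {Ω : Type*} [MeasurableSpace Ω]

/-- The Bayes risk `L̄(p) = E_p[L(Γ(p),·)]` of a loss `L` eliciting `Γ`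
is strictly concave along any segment joining two distributions in `P` whose
property values differ. -/
theorem stmt_9 {Ω : Type*} [MeasurableSpace Ω] {k : ℕ}
    (P : Set (Measure Ω)) (hP : ConvexClass P)
    (L : (Fin k → ℝ) → Ω → ℝ) (Γ : Measure Ω → Fin k → ℝ)
    (hint : ∀ p ∈ P, ∀ a : Fin k → ℝ, Integrable (L a) p)
    (hL : Elicits P L Γ)
    {p p' : Measure Ω} (hp : p ∈ P) (hp' : p' ∈ P) (hne : Γ p ≠ Γ p')
    {lam : ℝ} (h0 : 0 < lam) (h1 : lam < 1) :
    lam * (∫ ω, L (Γ p) ω ∂p) + (1 - lam) * (∫ ω, L (Γ p') ω ∂p') <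
      ∫ ω, L (Γ (mix lam p p')) ω ∂(mix lam p p') := by
  have hq : 0 < 1 - lam := by linarith
  have key : ∀ r, ∫ ω, L r ω ∂(mix lam p p') =
      lam * (∫ ω, L r ω ∂p) + (1 - lam) * (∫ ω, L r ω ∂p') := by
    intro r
    unfold mix
    rw [integral_add_measure ((hint p hp r).smul_measure ENNReal.ofReal_ne_top)
      ((hint p' hp' r).smul_measure ENNReal.ofReal_ne_top),
      integral_smul_measure, integral_smul_measure,
      ENNReal.toReal_ofReal h0.le, ENNReal.toReal_ofReal hq.le, smul_eq_mul, smul_eq_mul]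
  rw [key]
  generalize Γ (mix lam p p') = r
  have le : ∀ q ∈ P, ∫ ω, L (Γ q) ω ∂q ≤ ∫ ω, L r ω ∂q := by
    intro q hqP
    by_cases h : r = Γ q
    · rw [h]
    · exact (hL q hqP r h).le
  by_cases h : r = Γ p
  · have h' : r ≠ Γ p' := fun e => hne (h.symm.trans e)
    exact add_lt_add_of_le_of_lt (mul_le_mul_of_nonneg_left (le p hp) h0.le)
      (mul_lt_mul_of_pos_left (hL p' hp' r h') hq)
  · exact add_lt_add_of_lt_of_le (mul_lt_mul_of_pos_left (hL p hp r h) h0)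
      (mul_le_mul_of_nonneg_left (le p' hp') hq.le)

end Elicitation
end

section
/- Let X be a convex subset of a real vector space V and G : X → ℝ a convex function. Let x, x' ∈ X, λ ∈ (0,1), and x_λ = λx + (1−λ)x'. If there exists a linear functional d : V → ℝ that is a subgradient of G at x_λ but is a subgradient of G neither at x nor at x', then G(x_λ) < λ G(x) + (1−λ) G(x'). -/
/-- For convex `G : X → ℝ` on a convex subset `X` of a real vector
space `V`, if `x_λ = λ x + (1−λ) x'` with `λ ∈ (0,1)` and a linear functional `d`
is a subgradient of `G` at `x_λ` but is a subgradient neither at `x` nor at `x'`,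
then `G x_λ < λ G x + (1−λ) G x'`. -/
theorem stmt_16 {V : Type*} [AddCommGroup V] [Module ℝ V]
    {X : Set V} (hX : Convex ℝ X) {G : V → ℝ} (hG : ConvexOn ℝ X G)
    {x x' : V} (hx : x ∈ X) (hx' : x' ∈ X)
    {lam : ℝ} (h0 : 0 < lam) (h1 : lam < 1)
    (d : V →ₗ[ℝ] ℝ)
    (hmid : ∀ y ∈ X, G (lam • x + (1 - lam) • x') + d (y - (lam • x + (1 - lam) • x')) ≤ G y)
    (hnx : ¬ ∀ y ∈ X, G x + d (y - x) ≤ G y)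
    (hnx' : ¬ ∀ y ∈ X, G x' + d (y - x') ≤ G y) :
    G (lam • x + (1 - lam) • x') < lam * G x + (1 - lam) * G x' := by
  push Not at hnx hnx'
  obtain ⟨y, hy, hyx⟩ := hnx
  obtain ⟨z, hz, hzx⟩ := hnx'
  have hm := hmid y hy
  have hn := hmid z hz
  simp only [map_sub, map_add, map_smul, smul_eq_mul] at hm hn hyx hzx
  have a : G (lam • x + (1 - lam) • x') - (lam * d x + (1 - lam) * d x') < G x - d x := by
    linarith
  have b : G (lam • x + (1 - lam) • x') - (lam * d x + (1 - lam) * d x') < G x' - d x' := by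
    linarith
  have a' := mul_lt_mul_of_pos_left a h0
  have b' := mul_lt_mul_of_pos_left b (sub_pos.mpr h1)
  linarith
end

section
/- Let n ≥ 2 and let p, p' be Borel probability measures on ℝ with finite absolute n-th moments. For a probability measure q with finite n-th moment, let μ_n(q) = E_q[(y − E_q[y])^n] denote its n-th central moment. If the function λ ↦ μ_n(λ p + (1−λ) p') is constant on [0,1], then E_p[y] = E_{p'}[y]: the means of p and p' coincide. -/
open MeasureTheory

namespace Elicitation

variable {Ω : Type*} [MeasurableSpace Ω]

/-- The mean `E_p[y]` of a measure on `ℝ`. -/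
noncomputable def meanOf (p : Measure ℝ) : ℝ := ∫ y, y ∂p

/-- The `n`-th central moment `E_p[(y − E_p[y])^n]`. -/
noncomputable def centralMom (n : ℕ) (p : Measure ℝ) : ℝ :=
  ∫ y, (y - meanOf p) ^ n ∂p

lemma aux_int {n : ℕ} (p : Measure ℝ) [IsProbabilityMeasure p]
    (hp : Integrable (fun y : ℝ => |y| ^ n) p) {k : ℕ} (hk : k ≤ n) :
    Integrable (fun y : ℝ => y ^ k) p := by
  refine Integrable.mono' (hp.add (integrable_const (1:ℝ))) (by fun_prop) ?_
  filter_upwards with y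
  simp only [norm_pow, Real.norm_eq_abs, Pi.add_apply]
  rcases le_total |y| 1 with h | h
  · have h1 := pow_le_one₀ (n := k) (abs_nonneg y) h
    have h2 : 0 ≤ |y| ^ n := by positivity
    linarith
  · have := pow_le_pow_right₀ h hk
    linarith

lemma aux_mix (p p' : Measure ℝ) (f : ℝ → ℝ) (h : Integrable f p) (h' : Integrable f p')
    {l : ℝ} (hl : l ∈ Set.Icc (0:ℝ) 1) :
    Integrable f (mix l p p') ∧
    ∫ y, f y ∂(mix l p p') = ∫ y, f y ∂p' + l * (∫ y, f y ∂p - ∫ y, f y ∂p') := by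
  have i1 := h.smul_measure (c := ENNReal.ofReal l) ENNReal.ofReal_ne_top
  have i2 := h'.smul_measure (c := ENNReal.ofReal (1 - l)) ENNReal.ofReal_ne_top
  refine ⟨i1.add_measure i2, ?_⟩
  unfold mix
  rw [integral_add_measure i1 i2, integral_smul_measure, integral_smul_measure,
    ENNReal.toReal_ofReal hl.1, ENNReal.toReal_ofReal (by linarith [hl.2])]
  simp only [smul_eq_mul]
  ring

open Polynomial in
lemma aux_poly {n : ℕ} (hn : 2 ≤ n) (a b : ℕ → ℝ) (ha : a 0 = 1) (hb : b 0 = 0) (c : ℝ)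
    (h : ∀ l ∈ Set.Icc (0:ℝ) 1, ∑ k ∈ Finset.range (n+1),
      (a k + l * b k) * (-(a 1 + l * b 1)) ^ (n - k) * (n.choose k : ℝ) = c) : b 1 = 0 := by
  set M : ℝ[X] := C (a 1) + X * C (b 1) with hM
  set G : ℕ → ℝ[X] := fun k => (C (a k) + X * C (b k)) * (-M) ^ (n - k) * C (n.choose k : ℝ)
    with hG
  have hd : ∀ u v : ℝ, (C u + X * C v : ℝ[X]).natDegree ≤ 1 := by
    intro u v
    compute_degree
  have hdM : (-M).natDegree ≤ 1 := by rw [natDegree_neg]; exact hd _ _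
  have hF : (∑ k ∈ Finset.range (n+1), G k) = C c := by
    apply eq_of_infinite_eval_eq
    refine (Set.Icc_infinite (zero_lt_one (α := ℝ))).mono ?_
    intro l hl
    have := h l hl
    simp only [Set.mem_setOf_eq, eval_C, hG, hM, eval_finset_sum, eval_mul, eval_add, eval_pow,
      eval_neg, eval_X]
    exact this
  have hc : (∑ k ∈ Finset.range (n+1), G k).coeff n = 0 := by
    rw [hF, coeff_C_ne_zero (by omega)]
  obtain ⟨m, rfl⟩ : ∃ m, n = m + 2 := ⟨n - 2, by omega⟩
  rw [Finset.sum_range_succ', Finset.sum_range_succ', add_assoc, coeff_add] at hc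
  have hz : (∑ k ∈ Finset.range (m + 1), G (k + 1 + 1)).coeff (m + 2) = 0 := by
    rw [finset_sum_coeff]
    refine Finset.sum_eq_zero fun k hk => ?_
    have hk := Finset.mem_range.1 hk
    apply coeff_eq_zero_of_natDegree_lt
    have e1 : ((-M) ^ (m + 2 - (k+1+1))).natDegree ≤ (m + 2 - (k+1+1)) * 1 :=
      natDegree_pow_le_of_le _ hdM
    have e2 := natDegree_mul_le_of_le (hd (a (k+1+1)) (b (k+1+1))) e1
    have e3 := natDegree_mul_le_of_le e2 (natDegree_C ((m+2).choose (k+1+1) : ℝ)).le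
    simp only [hG]
    omega
  have h01 : G (0 + 1) + G 0 = (-M) ^ (m+2) * C (-(m + 1 : ℝ)) := by
    simp only [hG, zero_add, ha, hb, Nat.choose_one_right, Nat.choose_zero_right, ← hM]
    simp only [Nat.sub_zero, show m + 2 - 1 = m + 1 from rfl, map_one, map_zero, mul_zero,
      add_zero, Nat.cast_one, mul_one, one_mul, Nat.cast_add, Nat.cast_ofNat, map_neg, map_add]
    have : (C (2:ℝ) : ℝ[X]) = 1 + 1 := by rw [← C_1, ← C_add]; norm_num
    rw [this]
    ring
  rw [hz, h01, zero_add, coeff_mul_C] at hc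
  have := coeff_pow_of_natDegree_le (m := m + 2) hdM
  rw [mul_one] at this
  rw [this] at hc
  have hcM : (-M).coeff 1 = - b 1 := by
    simp [hM, coeff_C]
  rw [hcM] at hc
  rcases mul_eq_zero.1 hc with h1 | h1
  · simpa using h1
  · have : (0:ℝ) ≤ m := by positivity
    linarith

/-- For `n ≥ 2` and Borel probability measures `p, p'` on `ℝ` with finite
absolute `n`-th moments, if `λ ↦ μ_n(λ p + (1−λ) p')` is constant on `[0,1]`, then the
means of `p` and `p'` coincide. -/
theorem stmt_18 {n : ℕ} (hn : 2 ≤ n) (p p' : Measure ℝ)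
    [IsProbabilityMeasure p] [IsProbabilityMeasure p']
    (hp : Integrable (fun y : ℝ => |y| ^ n) p)
    (hp' : Integrable (fun y : ℝ => |y| ^ n) p')
    (hconst : ∀ lam₁ ∈ Set.Icc (0:ℝ) 1, ∀ lam₂ ∈ Set.Icc (0:ℝ) 1,
      centralMom n (mix lam₁ p p') = centralMom n (mix lam₂ p p')) :
    meanOf p = meanOf p' := by
  have I := fun k (hk : k ≤ n) => aux_int p hp hk
  have I' := fun k (hk : k ≤ n) => aux_int p' hp' hk
  have key := aux_poly hn (fun k => ∫ y, y ^ k ∂p') (fun k => ∫ y, y ^ k ∂p - ∫ y, y ^ k ∂p')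
    (by simp) (by simp) (centralMom n (mix 0 p p')) (by
      intro l hl
      rw [hconst 0 (by simp) l hl]
      have hm : meanOf (mix l p p') =
          ∫ y, y ^ 1 ∂p' + l * (∫ y, y ^ 1 ∂p - ∫ y, y ^ 1 ∂p') := by
        rw [← (aux_mix p p' (fun y => y ^ 1) (I 1 (by omega)) (I' 1 (by omega)) hl).2]
        simp [meanOf]
      unfold centralMom
      rw [← hm]
      simp only [sub_eq_add_neg (_ : ℝ) (meanOf _), add_pow]
      rw [integral_finset_sum]
      · refine Finset.sum_congr rfl fun k hk => ?_
        have hk : k ≤ n := by have := Finset.mem_range.1 hk; omega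
        rw [integral_mul_const, integral_mul_const, (aux_mix p p' _ (I k hk) (I' k hk) hl).2]
      · intro k hk
        have hk : k ≤ n := by have := Finset.mem_range.1 hk; omega
        exact ((aux_mix p p' _ (I k hk) (I' k hk) hl).1.mul_const _).mul_const _)
  simp only [pow_one] at key
  unfold meanOf
  linarith

end Elicitation
end
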